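/- The infinite RSRL R = (L(δδ*), φ) with φ(δ) = {a, b, ε} has a point-wise complement which is again an RSRL: { Σ* \ L | L ∈ R } equals the RSRL given by K' = L(δ₁δ₁δ₁*δ₂) with φ'(δ₁) = {a,b} and φ'(δ₂) = L((a+b)*). -/

import Mathlib

open Language Computability

/-- A substitution mapping symbols to languages, extended multiplicatively to words. -/
def phiW {Δ A : Type} (φ : Δ → Language A) (w : List Δ) : Language A :=
  (w.map φ).prod

/-- Image of a language of words under the extended substitution. -/
def phiL {Δ A : Type} (φ : Δ → Language A) (L : Set (List Δ)) : Language A :=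
  ⋃ w ∈ L, phiW φ w

/-- The set of languages generated by a generator language `K` and substitution `φ`. -/
def RSet {Δ A : Type} (φ : Δ → Language A) (K : Language Δ) : Set (Language A) :=
  { L | ∃ w ∈ K, phiW φ w = L }

/-- Rational sets of regular languages. -/
def IsRSRL {A : Type} (R : Set (Language A)) : Prop :=
  ∃ (Δ : Type) (_ : Fintype Δ) (K : Language Δ) (φ : Δ → Language A),
    K.IsRegular ∧ ([] : List Δ) ∉ K ∧ (∀ δ, (φ δ).IsRegular) ∧ R = RSet φ K

namespace Language

variable {α : Type*}

theorem mem_kstar_singleton {a : α} {w : List α} :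
    w ∈ ({[a]} : Language α)∗ ↔ ∃ n, w = List.replicate n a := by
  rw [mem_kstar]
  constructor
  · rintro ⟨S, rfl, hS⟩
    refine ⟨S.length, ?_⟩
    have : S = List.replicate S.length [a] := List.eq_replicate_iff.2 ⟨rfl, hS⟩
    rw [this]
    simp
  · rintro ⟨n, rfl⟩
    refine ⟨List.replicate n [a], by simp, fun y hy => List.eq_of_mem_replicate hy⟩

theorem isRegular_singleton (w : List α) : ({w} : Language α).IsRegular := by
  apply IsRegular.of_finite_range_leftQuotient
  refine ((w.tails.finite_toSet.image fun y => ({y} : Language α)).insert 0).subset ?_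
  rintro _ ⟨x, rfl⟩
  by_cases hx : x <+: w
  · obtain ⟨y, rfl⟩ := hx
    refine Or.inr ⟨y, by simp, ?_⟩
    ext z
    change z = y ↔ x ++ z = x ++ y
    simp
  · refine Or.inl ?_
    ext z
    refine iff_of_false (fun hz => hx ⟨z, hz⟩) (notMem_zero z)

theorem isRegular_top : (⊤ : Language α).IsRegular := by
  apply IsRegular.of_finite_range_leftQuotient
  refine (Set.finite_singleton (⊤ : Language α)).subset ?_
  rintro _ ⟨x, rfl⟩
  rfl

theorem isRegular_kstar_singleton (a : α) : (({[a]} : Language α)∗).IsRegular := by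
  apply IsRegular.of_finite_range_leftQuotient
  refine (Set.toFinite {({[a]} : Language α)∗, 0}).subset ?_
  rintro _ ⟨x, rfl⟩
  have key (w : List α) : w ∈ ({[a]} : Language α)∗ ↔ ∀ b ∈ w, b = a := by
    simp [mem_kstar_singleton, List.eq_replicate_iff]
  by_cases hx : ∀ b ∈ x, b = a
  · left
    ext z
    simp only [mem_leftQuotient, key, List.mem_append]
    grind
  · right
    ext z
    simp only [mem_leftQuotient, key, List.mem_append, notMem_zero]
    grind

theorem leftQuotient_mul (L M : Language α) (x : List α) :
    (L * M).leftQuotient x = L.leftQuotient x * M +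
      ⨆ v : {v : List α // ∃ u ∈ L, u ++ v = x}, M.leftQuotient v := by
  ext y
  simp only [mem_leftQuotient, mem_add, mem_mul, mem_iSup, Subtype.exists, exists_prop]
  constructor
  · rintro ⟨p, hp, q, hq, h⟩
    rcases List.append_eq_append_iff.1 h with ⟨c, rfl, rfl⟩ | ⟨c, rfl, rfl⟩
    · exact Or.inr ⟨c, ⟨p, hp, rfl⟩, hq⟩
    · exact Or.inl ⟨c, hp, q, hq, rfl⟩
  · rintro (⟨c, hc, q, hq, rfl⟩ | ⟨v, ⟨u, hu, rfl⟩, hv⟩)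
    · exact ⟨x ++ c, hc, q, hq, by simp⟩
    · exact ⟨u, hu, v ++ y, hv, by simp⟩

theorem IsRegular.mul {L M : Language α} (hL : L.IsRegular) (hM : M.IsRegular) :
    (L * M).IsRegular := by
  apply IsRegular.of_finite_range_leftQuotient
  refine (hL.finite_range_leftQuotient.image2 (fun Q S => Q * M + sSup S)
    hM.finite_range_leftQuotient.powerset).subset ?_
  rintro _ ⟨x, rfl⟩
  refine ⟨L.leftQuotient x, ⟨x, rfl⟩,
    Set.range fun v : {v : List α // ∃ u ∈ L, u ++ v = x} => M.leftQuotient v, ?_, ?_⟩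
  · rintro _ ⟨v, rfl⟩
    exact ⟨v, rfl⟩
  · rw [leftQuotient_mul]
    rfl

theorem mem_pow_nil_letters (n : ℕ) (w : List (Fin 2)) :
    w ∈ ({[], [0], [1]} : Language (Fin 2)) ^ n ↔ w.length ≤ n := by
  have letters (u : List (Fin 2)) : u ∈ ({[], [0], [1]} : Language (Fin 2)) ↔ u.length ≤ 1 := by
    change (u = [] ∨ u = [0] ∨ u = [1]) ↔ _
    match u with
    | [] => simp
    | [c] => fin_cases c <;> simp
    | _ :: _ :: _ => simp
  induction n generalizing w with
  | zero => simp
  | succ n ih =>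
    simp only [pow_succ', mem_mul, ih, letters]
    constructor
    · rintro ⟨u, hu, v, hv, rfl⟩
      simp only [List.length_append]
      lia
    · intro h
      exact ⟨w.take 1, by simp, w.drop 1, by simpa using by lia, List.take_append_drop 1 w⟩

theorem mem_pow_letters (n : ℕ) (w : List (Fin 2)) :
    w ∈ ({[0], [1]} : Language (Fin 2)) ^ n ↔ w.length = n := by
  have letters (u : List (Fin 2)) : u ∈ ({[0], [1]} : Language (Fin 2)) ↔ u.length = 1 := by
    change (u = [0] ∨ u = [1]) ↔ _
    match u with
    | [] => simp
    | [c] => fin_cases c <;> simp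
    | _ :: _ :: _ => simp
  induction n generalizing w with
  | zero => simp
  | succ n ih =>
    simp only [pow_succ', mem_mul, ih, letters]
    constructor
    · rintro ⟨u, hu, v, hv, rfl⟩
      simp only [List.length_append]
      lia
    · intro h
      exact ⟨w.take 1, by simp; lia, w.drop 1, by simp; lia, List.take_append_drop 1 w⟩

theorem pow_letters_mul_top (n : ℕ) :
    ({[0], [1]} : Language (Fin 2)) ^ (n + 1) * ⊤ =
      ({w : List (Fin 2) | w.length ≤ n} : Language (Fin 2))ᶜ := by
  ext w
  simp only [mem_mul, mem_pow_letters]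
  change _ ↔ ¬ w.length ≤ n
  constructor
  · rintro ⟨u, hu, v, -, rfl⟩
    simp only [List.length_append]
    lia
  · intro h
    exact ⟨w.take (n + 1), by simp; lia, w.drop (n + 1), trivial, by simp⟩

end Language

theorem phiW_replicate {Δ A : Type} (φ : Δ → Language A) (n : ℕ) (δ : Δ) :
    phiW φ (List.replicate n δ) = φ δ ^ n := by
  simp [phiW]

theorem phiW_append {Δ A : Type} (φ : Δ → Language A) (v w : List Δ) :
    phiW φ (v ++ w) = phiW φ v * phiW φ w := by
  simp [phiW]

theorem phiW_singleton {Δ A : Type} (φ : Δ → Language A) (δ : Δ) : phiW φ [δ] = φ δ := by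
  simp [phiW]

/-- The infinite RSRL `R = (δδ*, φ)` with `φ(δ) = {ε,a,b}`, i.e.
`R = { words of length ≤ i | i ≥ 1 }`, has a point-wise complement that is again
an RSRL, namely `(δ₁δ₁δ₁*δ₂, φ')` with `φ'(δ₁) = {a,b}`, `φ'(δ₂) = Σ*`. -/
theorem stmt12 :
    { L : Language (Fin 2) | ∃ i : ℕ, 1 ≤ i ∧
        L = { w : List (Fin 2) | w.length ≤ i } } =
      RSet (fun _ : Unit => ({[], [0], [1]} : Language (Fin 2)))
        (({[()]} : Language Unit) * ({[()]} : Language Unit)∗) ∧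
    { L' : Language (Fin 2) | ∃ i : ℕ, 1 ≤ i ∧
        L' = ({ w : List (Fin 2) | w.length ≤ i } : Language (Fin 2))ᶜ } =
      RSet (fun δ : Fin 2 => if δ = 0 then ({[0], [1]} : Language (Fin 2))
              else (Set.univ : Language (Fin 2)))
        (({[(0 : Fin 2)]} : Language (Fin 2)) * ({[(0 : Fin 2)]} : Language (Fin 2)) *
          ({[(0 : Fin 2)]} : Language (Fin 2))∗ * ({[(1 : Fin 2)]} : Language (Fin 2))) ∧
    IsRSRL { L' : Language (Fin 2) | ∃ i : ℕ, 1 ≤ i ∧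
        L' = ({ w : List (Fin 2) | w.length ≤ i } : Language (Fin 2))ᶜ } := by
  have compl_eq : { L' : Language (Fin 2) | ∃ i : ℕ, 1 ≤ i ∧
        L' = ({ w : List (Fin 2) | w.length ≤ i } : Language (Fin 2))ᶜ } =
      RSet (fun δ : Fin 2 => if δ = 0 then ({[0], [1]} : Language (Fin 2))
              else (Set.univ : Language (Fin 2)))
        (({[(0 : Fin 2)]} : Language (Fin 2)) * ({[(0 : Fin 2)]} : Language (Fin 2)) *
          ({[(0 : Fin 2)]} : Language (Fin 2))∗ * ({[(1 : Fin 2)]} : Language (Fin 2))) := by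
    have phi_eq (n : ℕ) : phiW (fun δ : Fin 2 => if δ = 0 then ({[0], [1]} : Language (Fin 2))
        else (Set.univ : Language (Fin 2))) (List.replicate (n + 1) 0 ++ [1]) =
          ({ w : List (Fin 2) | w.length ≤ n } : Language (Fin 2))ᶜ := by
      rw [phiW_append, phiW_replicate, phiW_singleton]
      exact pow_letters_mul_top n
    ext L
    constructor
    · rintro ⟨i, hi, rfl⟩
      obtain ⟨n, rfl⟩ := Nat.exists_eq_add_of_le' hi
      refine ⟨_, ?_, phi_eq (n + 1)⟩
      exact ⟨_, ⟨_, ⟨[0], rfl, [0], rfl, rfl⟩, _, mem_kstar_singleton.2 ⟨n, rfl⟩, rfl⟩,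
        [1], rfl, rfl⟩
    · rintro ⟨_, ⟨_, ⟨_, ⟨_, rfl, _, rfl, rfl⟩, _, hw, rfl⟩, _, rfl, rfl⟩, rfl⟩
      obtain ⟨n, rfl⟩ := mem_kstar_singleton.1 hw
      exact ⟨n + 1, by lia, phi_eq (n + 1)⟩
  refine ⟨?_, compl_eq, Fin 2, inferInstance, _, _, ?_, ?_, ?_, compl_eq⟩
  · have phi_eq (n : ℕ) : phiW (fun _ : Unit => ({[], [0], [1]} : Language (Fin 2)))
        (List.replicate n ()) = { w : List (Fin 2) | w.length ≤ n } := by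
      rw [phiW_replicate]
      ext w
      exact mem_pow_nil_letters n w
    ext L
    constructor
    · rintro ⟨i, hi, rfl⟩
      obtain ⟨n, rfl⟩ := Nat.exists_eq_add_of_le' hi
      exact ⟨_, append_mem_mul (a := [()]) rfl (mem_kstar_singleton.2 ⟨n, rfl⟩), phi_eq (n + 1)⟩
    · rintro ⟨_, ⟨_, rfl, _, hw, rfl⟩, rfl⟩
      obtain ⟨n, rfl⟩ := mem_kstar_singleton.1 hw
      exact ⟨n + 1, by lia, phi_eq (n + 1)⟩
  · exact (((isRegular_singleton _).mul (isRegular_singleton _)).mul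
      (isRegular_kstar_singleton _)).mul (isRegular_singleton _)
  · rintro ⟨_, -, _, rfl, h⟩
    simp at h
  · intro δ
    fin_cases δ
    · exact (isRegular_singleton [0]).add (isRegular_singleton [1])
    · exact isRegular_top
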